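/- arXiv:2505.23720 — 5 statements merged into one kernel-verified Lean document; each statement's English description precedes it below -/
import Mathlib

section
/- Let λ > 0, let x_1, …, x_n ∈ ℝ^d, ε_1, …, ε_n ∈ ℝ, and θ* ∈ ℝ^d, and set y_s = ⟨θ*, x_s⟩ + ε_s, V = λ I_d + Σ_{s=1}^n x_s x_sᵀ, and θ̂ = V⁻¹ Σ_{s=1}^n x_s y_s. Then ‖θ̂ − θ*‖_V ≤ ‖Σ_{s=1}^n x_s ε_s‖_{V⁻¹} + √λ · ‖θ*‖₂. -/
open Matrix Real

/-- The weighted norm `‖z‖_M = √(zᵀ M z)` of a vector with respect to a matrix `M`. -/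
noncomputable def wnorm {d : ℕ} (M : Matrix (Fin d) (Fin d) ℝ) (z : Fin d → ℝ) : ℝ :=
  Real.sqrt (z ⬝ᵥ M.mulVec z)

/-- The Euclidean norm `‖z‖₂ = √(zᵀ z)`. -/
noncomputable def l2norm {d : ℕ} (z : Fin d → ℝ) : ℝ :=
  Real.sqrt (z ⬝ᵥ z)

theorem l2norm_eq_norm_toLp {d : ℕ} (z : Fin d → ℝ) : l2norm z = ‖WithLp.toLp 2 z‖ := by
  simp [l2norm, EuclideanSpace.norm_eq, dotProduct, sq]

theorem l2norm_sub_le {d : ℕ} (a b : Fin d → ℝ) : l2norm (a - b) ≤ l2norm a + l2norm b := by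
  simpa only [l2norm_eq_norm_toLp, WithLp.toLp_sub] using norm_sub_le _ _

theorem wnorm_transpose_mul_self {d : ℕ} (B : Matrix (Fin d) (Fin d) ℝ) (z : Fin d → ℝ) :
    wnorm (Bᵀ * B) z = l2norm (B *ᵥ z) := by
  rw [wnorm, l2norm, ← mulVec_mulVec, dotProduct_mulVec, vecMul_transpose]

open scoped MatrixOrder in
theorem wnorm_sub_le {d : ℕ} {M : Matrix (Fin d) (Fin d) ℝ} (hM : M.PosSemidef)
    (a b : Fin d → ℝ) : wnorm M (a - b) ≤ wnorm M a + wnorm M b := by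
  obtain ⟨B, rfl⟩ := CStarAlgebra.nonneg_iff_eq_star_mul_self.mp hM.nonneg
  simpa only [star_eq_conjTranspose, conjTranspose_eq_transpose_of_trivial, wnorm_transpose_mul_self,
    mulVec_sub] using l2norm_sub_le _ _

theorem wnorm_inv_mulVec {d : ℕ} {M : Matrix (Fin d) (Fin d) ℝ} (hM : IsUnit M.det)
    (z : Fin d → ℝ) : wnorm M (M⁻¹ *ᵥ z) = wnorm M⁻¹ z := by
  rw [wnorm, wnorm, mulVec_mulVec, mul_nonsing_inv _ hM, one_mulVec, dotProduct_comm]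

/-- For `M = c • 1 + G` with `G` positive semidefinite, `‖c • u‖_M ≤ √c * ‖M u‖₂`. -/
theorem wnorm_smul_le_sqrt_mul_l2norm_mulVec {d : ℕ} {c : ℝ} (hc : 0 ≤ c)
    {G : Matrix (Fin d) (Fin d) ℝ} (hG : G.PosSemidef) (u : Fin d → ℝ) :
    wnorm (c • 1 + G) (c • u) ≤ √c * l2norm ((c • 1 + G) *ᵥ u) := by
  have h₁ : 0 ≤ u ⬝ᵥ G *ᵥ u := by simpa using hG.dotProduct_mulVec_nonneg u
  have h₂ : 0 ≤ G *ᵥ u ⬝ᵥ G *ᵥ u := by simpa using dotProduct_star_self_nonneg (G *ᵥ u)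
  rw [wnorm, l2norm, ← Real.sqrt_mul hc]
  apply Real.sqrt_le_sqrt
  simp only [add_mulVec, smul_mulVec, one_mulVec, mulVec_smul, dotProduct_add, add_dotProduct,
    smul_dotProduct, dotProduct_smul, smul_eq_mul, dotProduct_comm (G *ᵥ u) u]
  nlinarith [mul_nonneg (mul_nonneg hc hc) h₁, mul_nonneg hc h₂]

theorem stmt6 {d : ℕ} (lam : ℝ) (hlam : 0 < lam) (n : ℕ)
    (x : ℕ → Fin d → ℝ) (ε : ℕ → ℝ) (θs : Fin d → ℝ)
    (y : ℕ → ℝ) (hy : ∀ s, y s = θs ⬝ᵥ x s + ε s)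
    (V : Matrix (Fin d) (Fin d) ℝ)
    (hV : V = lam • (1 : Matrix (Fin d) (Fin d) ℝ)
      + ∑ s ∈ Finset.Icc 1 n, Matrix.vecMulVec (x s) (x s))
    (θhat : Fin d → ℝ)
    (hθhat : θhat = V⁻¹.mulVec (∑ s ∈ Finset.Icc 1 n, y s • x s)) :
    wnorm V (fun i => θhat i - θs i)
      ≤ wnorm V⁻¹ (∑ s ∈ Finset.Icc 1 n, ε s • x s) + Real.sqrt lam * l2norm θs := by
  have hG : (∑ s ∈ Finset.Icc 1 n, vecMulVec (x s) (x s)).PosSemidef :=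
    posSemidef_sum _ fun s _ => by simpa using posSemidef_vecMulVec_self_star (x s)
  have hpos : V.PosDef := hV ▸ (PosDef.one.smul hlam).add_posSemidef hG
  have hdet : IsUnit V.det := hpos.det_pos.ne'.isUnit
  have hsum : ∑ s ∈ Finset.Icc 1 n, y s • x s =
      ∑ s ∈ Finset.Icc 1 n, ε s • x s + (V *ᵥ θs - lam • θs) := by
    simp [hV, hy, add_smul, Finset.sum_add_distrib, add_mulVec, smul_mulVec, sum_mulVec,
      vecMulVec_mulVec, dotProduct_comm θs, add_comm]
  have herr : (fun i => θhat i - θs i) =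
      V⁻¹ *ᵥ (∑ s ∈ Finset.Icc 1 n, ε s • x s) - lam • V⁻¹ *ᵥ θs := by
    change θhat - θs = _
    rw [hθhat, hsum, mulVec_add, mulVec_sub, mulVec_mulVec, nonsing_inv_mul _ hdet, one_mulVec,
      mulVec_smul]
    abel
  have hbias : wnorm V (lam • V⁻¹ *ᵥ θs) ≤ √lam * l2norm θs := by
    have h := wnorm_smul_le_sqrt_mul_l2norm_mulVec hlam.le hG (V⁻¹ *ᵥ θs)
    rwa [← hV, mulVec_mulVec, mul_nonsing_inv _ hdet, one_mulVec] at h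
  rw [herr]
  refine (wnorm_sub_le hpos.posSemidef _ _).trans ?_
  rw [wnorm_inv_mulVec hdet]
  gcongr
end

section
/- Let V be a symmetric positive definite d×d real matrix, α ≥ 0, and θ*, θ̂ ∈ ℝ^d with ‖θ̂ − θ*‖_V ≤ α. Let A ⊆ ℝ^d be a finite nonempty set, let x* ∈ A maximize x ↦ ⟨θ*, x⟩ over A, and let x̂ ∈ A maximize x ↦ ⟨θ̂, x⟩ + α ‖x‖_{V⁻¹} over A. Then ⟨θ*, x*⟩ − ⟨θ*, x̂⟩ ≤ 2 α ‖x̂‖_{V⁻¹}. -/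
open Matrix Real

/-- Cauchy–Schwarz for the pair of dual weighted norms `‖·‖_M` and `‖·‖_{M⁻¹}`. -/
theorem abs_dotProduct_le_wnorm_mul_wnorm_inv {d : ℕ} {M : Matrix (Fin d) (Fin d) ℝ}
    (hM : M.PosDef) (w x : Fin d → ℝ) : |w ⬝ᵥ x| ≤ wnorm M w * wnorm M⁻¹ x := by
  have hMM : M *ᵥ (M⁻¹ *ᵥ x) = x := by
    rw [mulVec_mulVec, mul_nonsing_inv _ ((isUnit_iff_isUnit_det M).mp hM.isUnit), one_mulVec]
  have hnonneg (z : Fin d → ℝ) : 0 ≤ z ⬝ᵥ M *ᵥ z := by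
    simpa using hM.posSemidef.dotProduct_mulVec_nonneg z
  have hsymm : (Matrix.toLinearMap₂' ℝ M).IsSymm := by
    refine ⟨fun u v => ?_⟩
    have hT : Mᵀ = M := by simpa using hM.isHermitian.eq
    simp only [toLinearMap₂'_apply', RingHom.id_apply]
    rw [dotProduct_mulVec, ← mulVec_transpose, hT, dotProduct_comm]
  have hCS := LinearMap.BilinForm.apply_sq_le_of_symm (Matrix.toLinearMap₂' ℝ M)
    (fun z => by simpa [toLinearMap₂'_apply'] using hnonneg z) hsymm w (M⁻¹ *ᵥ x)
  simp only [toLinearMap₂'_apply', hMM] at hCS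
  rw [wnorm, wnorm, ← Real.sqrt_mul (hnonneg w), dotProduct_comm x]
  exact Real.abs_le_sqrt hCS

theorem stmt7 {d : ℕ} (V : Matrix (Fin d) (Fin d) ℝ) (hV : V.PosDef)
    (α : ℝ) (hα : 0 ≤ α) (θs θhat : Fin d → ℝ)
    (hconf : wnorm V (fun i => θhat i - θs i) ≤ α)
    (A : Finset (Fin d → ℝ)) (hA : A.Nonempty)
    (xstar xhat : Fin d → ℝ)
    (hxstarA : xstar ∈ A)
    (hxstar : ∀ z ∈ A, θs ⬝ᵥ z ≤ θs ⬝ᵥ xstar)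
    (hxhatA : xhat ∈ A)
    (hxhat : ∀ z ∈ A, θhat ⬝ᵥ z + α * wnorm V⁻¹ z ≤ θhat ⬝ᵥ xhat + α * wnorm V⁻¹ xhat) :
    θs ⬝ᵥ xstar - θs ⬝ᵥ xhat ≤ 2 * α * wnorm V⁻¹ xhat := by
  have hdual (x : Fin d → ℝ) : |θhat ⬝ᵥ x - θs ⬝ᵥ x| ≤ α * wnorm V⁻¹ x := by
    rw [← sub_dotProduct]
    exact (abs_dotProduct_le_wnorm_mul_wnorm_inv hV (θhat - θs) x).trans
      (mul_le_mul_of_nonneg_right hconf (Real.sqrt_nonneg _))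
  linarith [hxhat xstar hxstarA, (abs_le.mp (hdual xstar)).1, (abs_le.mp (hdual xhat)).2]
end

section
/- Let d ≥ 1, L > 0, λ ≥ max(1, L²), and let x_1, …, x_T ∈ ℝ^d satisfy ‖x_t‖₂ ≤ L for all t. Set V_t = λ I_d + Σ_{s=1}^{t−1} x_s x_sᵀ. Let 0 < α_1 ≤ α_2 ≤ … ≤ α_T be a nondecreasing sequence of positive reals, and let r_1, …, r_T be reals satisfying r_t ≤ 2 α_t ‖x_t‖_{V_t⁻¹} for every t. Then Σ_{t=1}^T r_t ≤ 2 α_T √( 2 d T log( 1 + T L² / (d λ) ) ). -/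
open Matrix Real

/-- The regularized Gram matrix `lam I + ∑_{s=1}^n x_s x_sᵀ`. -/
noncomputable def regGram {d : ℕ} (lam : ℝ) (x : ℕ → Fin d → ℝ) (n : ℕ) :
    Matrix (Fin d) (Fin d) ℝ :=
  lam • (1 : Matrix (Fin d) (Fin d) ℝ) + ∑ s ∈ Finset.Icc 1 n, Matrix.vecMulVec (x s) (x s)

theorem posSemidef_sum_vecMulVec_self {ι n : Type*} [Fintype n] (s : Finset ι) (x : ι → n → ℝ) :
    (∑ i ∈ s, Matrix.vecMulVec (x i) (x i)).PosSemidef :=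
  Matrix.posSemidef_sum s fun i _ => by
    simpa using Matrix.posSemidef_vecMulVec_self_star (x i)

theorem posDef_smul_one_add {n : Type*} [Fintype n] [DecidableEq n] {S : Matrix n n ℝ}
    (hS : S.PosSemidef) {lam : ℝ} (hlam : 0 < lam) : (lam • (1 : Matrix n n ℝ) + S).PosDef :=
  (Matrix.PosDef.one.smul hlam).add_posSemidef hS

theorem posDef_regGram {d : ℕ} {lam : ℝ} (hlam : 0 < lam) (x : ℕ → Fin d → ℝ) (n : ℕ) :
    (regGram lam x n).PosDef :=
  posDef_smul_one_add (posSemidef_sum_vecMulVec_self _ x) hlam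

theorem dotProduct_inv_mulVec_le {n : Type*} [Fintype n] [DecidableEq n] {S : Matrix n n ℝ}
    (hS : S.PosSemidef) {lam : ℝ} (hlam : 0 < lam) (z : n → ℝ) :
    z ⬝ᵥ (lam • (1 : Matrix n n ℝ) + S)⁻¹ *ᵥ z ≤ z ⬝ᵥ z / lam := by
  have hA := posDef_smul_one_add hS hlam
  set A := lam • (1 : Matrix n n ℝ) + S with hAdef
  set y := A⁻¹ *ᵥ z
  have hAy : A *ᵥ y = z := by
    simp [y, Matrix.mulVec_mulVec, Matrix.mul_nonsing_inv _ hA.det_pos.ne'.isUnit]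
  have hquad : lam * (y ⬝ᵥ y) ≤ z ⬝ᵥ y := by
    have h := hS.dotProduct_mulVec_nonneg y
    rw [star_trivial] at h
    rw [dotProduct_comm z, ← hAy, hAdef, Matrix.add_mulVec, dotProduct_add, Matrix.smul_mulVec,
      Matrix.one_mulVec, dotProduct_smul, smul_eq_mul]
    linarith
  have hsq : 0 ≤ (z - lam • y) ⬝ᵥ (z - lam • y) := dotProduct_self_star_nonneg (z - lam • y)
  rw [le_div_iff₀ hlam]
  simp only [sub_dotProduct, dotProduct_sub, smul_dotProduct, dotProduct_smul, smul_eq_mul,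
    dotProduct_comm y z] at hsq
  nlinarith

theorem det_add_vecMulVec_self {n : Type*} [Fintype n] [DecidableEq n] {A : Matrix n n ℝ}
    (hA : IsUnit A.det) (z : n → ℝ) :
    (A + Matrix.vecMulVec z z).det = A.det * (1 + z ⬝ᵥ A⁻¹ *ᵥ z) := by
  rw [Matrix.vecMulVec_eq Unit, Matrix.det_add_replicateCol_mul_replicateRow hA,
    Matrix.det_unique (n := Unit),
    Matrix.mul_assoc]
  simp [Matrix.mul_apply, Matrix.mulVec, dotProduct]

theorem log_det_le_of_trace_le {n : Type*} [Fintype n] [DecidableEq n] {A : Matrix n n ℝ}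
    (hA : A.PosDef) {m : ℝ} (hm : 0 < m) (htr : A.trace ≤ Fintype.card n * m) :
    Real.log A.det ≤ Fintype.card n * Real.log m := by
  have hdet := hA.1.det_eq_prod_eigenvalues
  have htrace := hA.1.trace_eq_sum_eigenvalues
  simp only [RCLike.ofReal_real_eq_id, id] at hdet htrace
  have hlog (i : n) :
      Real.log (hA.1.eigenvalues i) ≤ Real.log m + (hA.1.eigenvalues i / m - 1) := by
    have h := Real.log_le_sub_one_of_pos (div_pos (hA.eigenvalues_pos i) hm)
    rw [Real.log_div (hA.eigenvalues_pos i).ne' hm.ne'] at h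
    linarith
  calc Real.log A.det = ∑ i, Real.log (hA.1.eigenvalues i) := by
        rw [hdet, Real.log_prod fun i _ => (hA.eigenvalues_pos i).ne']
    _ ≤ ∑ i, (Real.log m + (hA.1.eigenvalues i / m - 1)) := Finset.sum_le_sum fun i _ => hlog i
    _ = Fintype.card n * Real.log m + (A.trace / m - Fintype.card n) := by
        simp [Finset.sum_add_distrib, htrace, Finset.sum_div]
    _ ≤ Fintype.card n * Real.log m := by
        have : A.trace / m ≤ Fintype.card n := (div_le_iff₀ hm).2 htr
        linarith

theorem le_two_mul_log_one_add {q : ℝ} (h0 : 0 ≤ q) (h2 : q ≤ 2) : q ≤ 2 * Real.log (1 + q) := by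
  have h := Real.le_log_one_add_of_nonneg h0
  have : q / 2 ≤ 2 * q / (q + 2) := by
    rw [div_le_div_iff₀ two_pos (by linarith)]
    nlinarith
  linarith

theorem log_det_regGram {d : ℕ} {lam : ℝ} (hlam : 0 < lam) (x : ℕ → Fin d → ℝ) (T : ℕ) :
    Real.log (regGram lam x T).det = d * Real.log lam +
      ∑ t ∈ Finset.Icc 1 T, Real.log (1 + x t ⬝ᵥ (regGram lam x (t - 1))⁻¹ *ᵥ x t) := by
  induction T with
  | zero => simp [regGram]
  | succ n ih =>
    have hpos := posDef_regGram hlam x n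
    have hq : 0 ≤ x (n + 1) ⬝ᵥ (regGram lam x n)⁻¹ *ᵥ x (n + 1) :=
      hpos.inv.posSemidef.dotProduct_mulVec_nonneg (x (n + 1))
    have hsucc : regGram lam x (n + 1) =
        regGram lam x n + Matrix.vecMulVec (x (n + 1)) (x (n + 1)) := by
      simp [regGram, Finset.sum_Icc_succ_top, add_assoc]
    rw [hsucc, det_add_vecMulVec_self hpos.det_pos.ne'.isUnit,
      Real.log_mul hpos.det_pos.ne' (by positivity), ih,
      Finset.sum_Icc_succ_top (by omega), Nat.add_sub_cancel, add_assoc]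

/-- The elliptical potential inequality. -/
theorem sum_dotProduct_inv_regGram_le {d : ℕ} (hd : 1 ≤ d) {L lam : ℝ} (hlam : 0 < lam)
    (hL : L ^ 2 ≤ lam) (x : ℕ → Fin d → ℝ) (T : ℕ)
    (hx : ∀ t ∈ Finset.Icc 1 T, x t ⬝ᵥ x t ≤ L ^ 2) :
    ∑ t ∈ Finset.Icc 1 T, x t ⬝ᵥ (regGram lam x (t - 1))⁻¹ *ᵥ x t ≤
      2 * d * Real.log (1 + T * L ^ 2 / (d * lam)) := by
  have hd' : (0 : ℝ) < d := by exact_mod_cast hd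
  have hfac : 0 < 1 + T * L ^ 2 / (d * lam) := by positivity
  have htr : (regGram lam x T).trace ≤
      Fintype.card (Fin d) * (lam * (1 + T * L ^ 2 / (d * lam))) := by
    calc (regGram lam x T).trace = lam * d + ∑ t ∈ Finset.Icc 1 T, x t ⬝ᵥ x t := by
          simp [regGram, Matrix.trace_sum, Matrix.trace_vecMulVec]
      _ ≤ lam * d + ∑ t ∈ Finset.Icc 1 T, L ^ 2 := by
          gcongr with t ht
          exact hx t ht
      _ = _ := by
          simp
          field_simp
  have hdet := log_det_le_of_trace_le (posDef_regGram hlam x T) (mul_pos hlam hfac) htr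
  rw [log_det_regGram hlam, Real.log_mul hlam.ne' hfac.ne', Fintype.card_fin] at hdet
  calc _ ≤ ∑ t ∈ Finset.Icc 1 T,
        2 * Real.log (1 + x t ⬝ᵥ (regGram lam x (t - 1))⁻¹ *ᵥ x t) := by
        refine Finset.sum_le_sum fun t ht => le_two_mul_log_one_add
          ((posDef_regGram hlam x (t - 1)).inv.posSemidef.dotProduct_mulVec_nonneg (x t)) ?_
        have hle : x t ⬝ᵥ x t / lam ≤ 1 := (div_le_one hlam).2 ((hx t ht).trans hL)
        have := dotProduct_inv_mulVec_le
          (posSemidef_sum_vecMulVec_self (Finset.Icc 1 (t - 1)) x) hlam (x t)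
        exact (this.trans hle).trans one_le_two
    _ ≤ _ := by
        rw [← Finset.mul_sum]
        linarith

theorem stmt10 {d : ℕ} (hd : 1 ≤ d) (L lam : ℝ) (hL : 0 < L)
    (hlam : max 1 (L ^ 2) ≤ lam) (T : ℕ)
    (x : ℕ → Fin d → ℝ) (hx : ∀ t ∈ Finset.Icc 1 T, l2norm (x t) ≤ L)
    (V : ℕ → Matrix (Fin d) (Fin d) ℝ)
    (hV : ∀ t, V t = lam • (1 : Matrix (Fin d) (Fin d) ℝ)
      + ∑ s ∈ Finset.Icc 1 (t - 1), Matrix.vecMulVec (x s) (x s))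
    (α : ℕ → ℝ)
    (hαpos : ∀ t ∈ Finset.Icc 1 T, 0 < α t)
    (hαmono : ∀ s ∈ Finset.Icc 1 T, ∀ t ∈ Finset.Icc 1 T, s ≤ t → α s ≤ α t)
    (r : ℕ → ℝ)
    (hr : ∀ t ∈ Finset.Icc 1 T, r t ≤ 2 * α t * wnorm (V t)⁻¹ (x t)) :
    ∑ t ∈ Finset.Icc 1 T, r t
      ≤ 2 * α T * Real.sqrt (2 * d * T * Real.log (1 + T * L ^ 2 / (d * lam))) := by
  have hlam0 : 0 < lam := zero_lt_one.trans_le ((le_max_left _ _).trans hlam)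
  have hV' (t : ℕ) : V t = regGram lam x (t - 1) := hV t
  have hsq (t : ℕ) : wnorm (V t)⁻¹ (x t) ^ 2 = x t ⬝ᵥ (regGram lam x (t - 1))⁻¹ *ᵥ x t := by
    rw [wnorm, hV']
    exact Real.sq_sqrt
      ((posDef_regGram hlam0 x (t - 1)).inv.posSemidef.dotProduct_mulVec_nonneg (x t))
  have hpot := sum_dotProduct_inv_regGram_le hd hlam0 ((le_max_right _ _).trans hlam) x T
    fun t ht => (Real.sqrt_le_left hL.le).1 (hx t ht)
  rcases Nat.eq_zero_or_pos T with rfl | hT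
  · simp
  have hTmem : T ∈ Finset.Icc 1 T := Finset.mem_Icc.2 ⟨hT, le_rfl⟩
  have hαT := hαpos T hTmem
  calc ∑ t ∈ Finset.Icc 1 T, r t
      ≤ ∑ t ∈ Finset.Icc 1 T, 2 * α T * wnorm (V t)⁻¹ (x t) := by
        refine Finset.sum_le_sum fun t ht => (hr t ht).trans ?_
        have := hαmono t ht T hTmem (Finset.mem_Icc.1 ht).2
        have : 0 ≤ wnorm (V t)⁻¹ (x t) := Real.sqrt_nonneg _
        gcongr
    _ = 2 * α T * ∑ t ∈ Finset.Icc 1 T, wnorm (V t)⁻¹ (x t) := by rw [Finset.mul_sum]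
    _ ≤ _ := by
        gcongr
        apply Real.le_sqrt_of_sq_le
        refine sq_sum_le_card_mul_sum_sq.trans ?_
        simp only [hsq, Nat.card_Icc, Nat.add_sub_cancel]
        calc _ ≤ (T : ℝ) * (2 * d * Real.log (1 + T * L ^ 2 / (d * lam))) := by gcongr
          _ = _ := by ring
end

section
/- Let M and N be symmetric positive definite d×d real matrices with M − N positive semidefinite. Then for every x ∈ ℝ^d, xᵀ M x ≤ ( det(M) / det(N) ) · xᵀ N x. Equivalently, if A and B are symmetric positive definite with B − A positive semidefinite, then for every x ∈ ℝ^d, xᵀ A⁻¹ x ≤ ( det(B) / det(A) ) · xᵀ B⁻¹ x. -/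
open Matrix

section DetRatio

variable {n : Type*} [Fintype n] [DecidableEq n]

theorem Matrix.IsHermitian.posSemidef_sub_one_iff {A : Matrix n n ℝ} (hA : A.IsHermitian) :
    (A - 1).PosSemidef ↔ ∀ i, 1 ≤ hA.eigenvalues i := by
  have h : A - 1 = Unitary.conjStarAlgAut ℝ _ hA.eigenvectorUnitary
      (diagonal fun i => hA.eigenvalues i - 1) := by
    rw [← diagonal_sub, map_sub, diagonal_one, map_one]
    conv_lhs => rw [hA.spectral_theorem]
    rfl
  rw [h]
  simp [Unitary.isUnit_coe.posSemidef_star_right_conjugate_iff, posSemidef_diagonal_iff]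

theorem Matrix.IsHermitian.posSemidef_smul_one_sub_iff {A : Matrix n n ℝ} (hA : A.IsHermitian)
    (c : ℝ) : (c • 1 - A).PosSemidef ↔ ∀ i, hA.eigenvalues i ≤ c := by
  have h : c • 1 - A = Unitary.conjStarAlgAut ℝ _ hA.eigenvectorUnitary
      (diagonal fun i => c - hA.eigenvalues i) := by
    rw [← diagonal_sub, map_sub, ← smul_one_eq_diagonal, map_smul, map_one]
    conv_lhs => rw [hA.spectral_theorem]
    rfl
  rw [h]
  simp [Unitary.isUnit_coe.posSemidef_star_right_conjugate_iff, posSemidef_diagonal_iff]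

/-- A real symmetric matrix `A ≥ 1` satisfies `A ≤ det A • 1`. -/
theorem Matrix.IsHermitian.posSemidef_det_smul_one_sub {A : Matrix n n ℝ} (hA : A.IsHermitian)
    (h : (A - 1).PosSemidef) : (A.det • 1 - A).PosSemidef := by
  have h1 := hA.posSemidef_sub_one_iff.mp h
  rw [hA.posSemidef_smul_one_sub_iff, hA.det_eq_prod_eigenvalues]
  intro i
  simpa using Finset.prod_le_prod_of_subset_of_one_le (Finset.subset_univ {i})
    (fun j _ => zero_le_one.trans (h1 j)) (fun j _ _ => h1 j)

/-- If `N ≤ M` in the Loewner order with `N` positive definite, then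
`M ≤ (det M / det N) • N`. -/
theorem Matrix.PosDef.posSemidef_det_div_det_smul_sub {M N : Matrix n n ℝ} (hM : M.IsHermitian)
    (hN : N.PosDef) (h : (M - N).PosSemidef) : ((M.det / N.det) • N - M).PosSemidef := by
  open scoped MatrixOrder in
  obtain ⟨B, rfl⟩ := CStarAlgebra.nonneg_iff_eq_star_mul_self.mp hN.posSemidef.nonneg
  rw [star_eq_conjTranspose] at *
  have hdet : B.det ≠ 0 := fun h0 => hN.det_pos.ne' (by simp [h0])
  have hB : IsUnit B.det := hdet.isUnit
  have hB' : IsUnit Bᴴ.det := by simpa using hB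
  set A := B⁻¹ᴴ * M * B⁻¹ with hA
  have hAM : Bᴴ * A * B = M := by
    rw [hA, conjTranspose_nonsing_inv, Matrix.mul_assoc, nonsing_inv_mul_cancel_right _ _ hB,
      mul_nonsing_inv_cancel_left _ _ hB']
  have hA1 : A - 1 = B⁻¹ᴴ * (M - Bᴴ * B) * B⁻¹ := by
    rw [Matrix.mul_sub, Matrix.sub_mul, conjTranspose_nonsing_inv,
      nonsing_inv_mul_cancel_left _ _ hB', mul_nonsing_inv _ hB, hA, conjTranspose_nonsing_inv]
  have hdetA : M.det / (Bᴴ * B).det = A.det := by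
    rw [← hAM]
    simp only [det_mul, det_conjTranspose, star_trivial]
    field_simp
  have key := ((isHermitian_conjTranspose_mul_mul B⁻¹ hM).posSemidef_det_smul_one_sub
    (hA1 ▸ h.conjTranspose_mul_mul_same B⁻¹)).conjTranspose_mul_mul_same B
  rw [← hA, Matrix.mul_sub, Matrix.sub_mul, hAM] at key
  rw [hdetA]
  simpa using key

/-- Inversion reverses the Loewner order on positive definite matrices. -/
theorem Matrix.PosDef.posSemidef_inv_sub_inv {A B : Matrix n n ℝ} (hA : A.PosDef) (hB : B.PosDef)
    (h : (B - A).PosSemidef) : (A⁻¹ - B⁻¹).PosSemidef := by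
  have := hA.isUnit.invertible
  have := hB.isUnit.invertible
  have := hA.inv.isUnit.invertible
  simpa using (hB.fromBlocks₁₁ 1 A⁻¹).mp ((hA.inv.fromBlocks₂₂ B 1).mpr (by simpa using h))

theorem Matrix.PosDef.dotProduct_mulVec_le_det_div_det_mul {M N : Matrix n n ℝ}
    (hM : M.IsHermitian) (hN : N.PosDef) (h : (M - N).PosSemidef) (x : n → ℝ) :
    x ⬝ᵥ M.mulVec x ≤ (M.det / N.det) * (x ⬝ᵥ N.mulVec x) := by
  have := (hN.posSemidef_det_div_det_smul_sub hM h).dotProduct_mulVec_nonneg x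
  simpa [sub_mulVec, smul_mulVec, dotProduct_sub] using this

end DetRatio

theorem stmt15 {d : ℕ} :
    (∀ M N : Matrix (Fin d) (Fin d) ℝ, M.PosDef → N.PosDef → (M - N).PosSemidef →
      ∀ x : Fin d → ℝ, x ⬝ᵥ M.mulVec x ≤ (M.det / N.det) * (x ⬝ᵥ N.mulVec x)) ∧
    (∀ A B : Matrix (Fin d) (Fin d) ℝ, A.PosDef → B.PosDef → (B - A).PosSemidef →
      ∀ x : Fin d → ℝ, x ⬝ᵥ A⁻¹.mulVec x ≤ (B.det / A.det) * (x ⬝ᵥ B⁻¹.mulVec x)) := by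
  refine ⟨fun M N hM hN h => hN.dotProduct_mulVec_le_det_div_det_mul hM.1 h,
    fun A B hA hB h x => ?_⟩
  have := hB.inv.dotProduct_mulVec_le_det_div_det_mul hA.inv.1
    (hA.posSemidef_inv_sub_inv hB h) x
  rwa [det_nonsing_inv, det_nonsing_inv, Ring.inverse_eq_inv', inv_div_inv] at this
end

section
/- Let X be a type, f : X → ℝ a function, Δ_min > 0, and for each t ∈ {1, …, T} let f_t : X → ℝ and h_t : X → [0, ∞) be functions and A_t ⊆ X a finite nonempty set. Suppose for all t and all x ∈ A_t, |f_t(x) − f(x)| ≤ h_t(x). For each t, let x*_t ∈ A_t maximize f over A_t and let x_t ∈ A_t maximize x ↦ f_t(x) + h_t(x) over A_t, and suppose that for every t with f(x_t) < f(x*_t) the gap satisfies f(x*_t) − f(x_t) ≥ Δ_min. Then #{ t ≤ T : f(x_t) < f(x*_t) } ≤ (2 / Δ_min) · √( T · Σ_{t=1}^T h_t(x_t)² ). -/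
theorem stmt18 {X : Type*} (T : ℕ) (f : X → ℝ) (Δmin : ℝ) (hΔ : 0 < Δmin)
    (ft ht : ℕ → X → ℝ) (hht : ∀ t x, 0 ≤ ht t x)
    (A : ℕ → Finset X) (hA : ∀ t, (A t).Nonempty)
    (hconf : ∀ t ∈ Finset.Icc 1 T, ∀ x ∈ A t, |ft t x - f x| ≤ ht t x)
    (xstar xsel : ℕ → X)
    (hxstarA : ∀ t ∈ Finset.Icc 1 T, xstar t ∈ A t)
    (hxstar : ∀ t ∈ Finset.Icc 1 T, ∀ z ∈ A t, f z ≤ f (xstar t))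
    (hxselA : ∀ t ∈ Finset.Icc 1 T, xsel t ∈ A t)
    (hxsel : ∀ t ∈ Finset.Icc 1 T, ∀ z ∈ A t,
      ft t z + ht t z ≤ ft t (xsel t) + ht t (xsel t))
    (hgap : ∀ t ∈ Finset.Icc 1 T, f (xsel t) < f (xstar t) →
      Δmin ≤ f (xstar t) - f (xsel t)) :
    ((((Finset.Icc 1 T).filter (fun t => f (xsel t) < f (xstar t))).card : ℝ))
      ≤ (2 / Δmin) * Real.sqrt (T * ∑ t ∈ Finset.Icc 1 T, (ht t (xsel t)) ^ 2) := by
  set S := (Finset.Icc 1 T).filter (fun t => f (xsel t) < f (xstar t))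
  have hround : ∀ t ∈ S, Δmin ≤ 2 * ht t (xsel t) := by
    intro t htS
    obtain ⟨htT, hlt⟩ := Finset.mem_filter.mp htS
    have hgap_t := hgap t htT hlt
    have hstar := abs_le.mp (hconf t htT _ (hxstarA t htT))
    have hsel := abs_le.mp (hconf t htT _ (hxselA t htT))
    have hopt := hxsel t htT _ (hxstarA t htT)
    linarith [hstar.1, hsel.2]
  have hcard : (S.card : ℝ) * Δmin ≤ 2 * ∑ t ∈ Finset.Icc 1 T, ht t (xsel t) := by
    calc (S.card : ℝ) * Δmin ≤ ∑ t ∈ S, 2 * ht t (xsel t) := by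
          simpa only [nsmul_eq_mul] using Finset.card_nsmul_le_sum S _ Δmin hround
      _ ≤ ∑ t ∈ Finset.Icc 1 T, 2 * ht t (xsel t) :=
          Finset.sum_le_sum_of_subset_of_nonneg (Finset.filter_subset _ _)
            fun t _ _ => mul_nonneg zero_le_two (hht t _)
      _ = 2 * ∑ t ∈ Finset.Icc 1 T, ht t (xsel t) := (Finset.mul_sum _ _ _).symm
  have hcs : ∑ t ∈ Finset.Icc 1 T, ht t (xsel t)
      ≤ Real.sqrt (T * ∑ t ∈ Finset.Icc 1 T, (ht t (xsel t)) ^ 2) := by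
    apply Real.le_sqrt_of_sq_le
    simpa using sq_sum_le_card_mul_sum_sq (s := Finset.Icc 1 T) (f := fun t => ht t (xsel t))
  rw [div_mul_eq_mul_div, le_div_iff₀ hΔ]
  linarith
end
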